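/- For every homeomorphism h : L₊² → L₊², either the set {α ∈ ω₁ ∖ {0} : h(L₊ × {α}) = L₊ × {α}} is a closed unbounded subset of ω₁, or the set {α ∈ ω₁ ∖ {0} : h(L₊ × {α}) = {α} × L₊} is a closed unbounded subset of ω₁. (In particular, for an orientation-preserving homeomorphism the first alternative holds; composing an orientation-reversing homeomorphism with the coordinate swap reduces to this case.) -/

import Mathlib

open Set

noncomputable section

/-- `ω₁`, the set of countable ordinals, with its (order) topology inherited from the
order topology on `Ordinal`. -/
abbrev Omega1 : Type 1 := {o : Ordinal.{0} // o < (Cardinal.aleph 1).ord}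

/-- The zero ordinal, as an element of `ω₁`. -/
def o0 : Omega1 := ⟨0, by simp only [Cardinal.ord_aleph]; exact Ordinal.omega_pos 1⟩

/-- The half-open unit interval `[0,1) ⊆ ℝ`. -/
abbrev Ico01 : Type := (Set.Ico (0:ℝ) 1)

/-- The closed long ray `L_{≥0} = ω₁ × [0,1)` with the lexicographic order. -/
abbrev LongRayCl : Type 1 := Omega1 ×ₗ Ico01

/-- The closed long ray carries the order topology of the lexicographic order. -/
instance : TopologicalSpace LongRayCl := Preorder.topology LongRayCl
instance : OrderTopology LongRayCl := ⟨rfl⟩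

/-- `0 ∈ [0,1)`. -/
def r0 : Ico01 := ⟨0, ⟨le_refl 0, one_pos⟩⟩

/-- The initial point `(0,0)` of the closed long ray. -/
def lzero : LongRayCl := toLex (o0, r0)

/-- The open long ray `L₊ = L_{≥0} ∖ {(0,0)}` with the subspace topology. -/
abbrev LongRay : Type 1 := {x : LongRayCl // x ≠ lzero}

/-- The identification of a nonzero countable ordinal `α` with the point `(α,0)`
of the open long ray. -/
def atOrd (α : Omega1) (hα : α ≠ o0) : LongRay :=
  ⟨toLex (α, r0), fun h => hα (congrArg (fun x : LongRayCl => (ofLex x).1) h)⟩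


/-- A subset of `ω₁` is unbounded if it is cofinal in `ω₁`. -/
def UnboundedIn (C : Set Omega1) : Prop := ∀ β : Omega1, ∃ γ ∈ C, β < γ

/-- A club subset of `ω₁`: closed in the order topology and unbounded. -/
def IsClubIn (C : Set Omega1) : Prop := IsClosed C ∧ UnboundedIn C

/-- The horizontal line `L₊ × {a}` in `L₊²`. -/
def horizLine (a : LongRay) : Set (LongRay × LongRay) := {p | p.2 = a}

/-- The vertical line `{a} × L₊` in `L₊²`. -/
def vertLine (a : LongRay) : Set (LongRay × LongRay) := {p | p.1 = a}

open Filter Topology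

/-- The order-theoretic features of a long ray: no endpoints, countable sets are
bounded, bounded nonempty sets have suprema, and initial segments have countable order-dense
subsets. -/
class LongOrder (X : Type*) [LinearOrder X] : Prop extends
    Nontrivial X, NoMinOrder X, NoMaxOrder X where
  bddAbove_of_countable : ∀ s : Set X, s.Countable → BddAbove s
  exists_isLUB : ∀ s : Set X, s.Nonempty → BddAbove s → ∃ a, IsLUB s a
  exists_countable_dense : ∀ b : X, ∃ D : Set X, D.Countable ∧
    ∀ p q, p < q → q ≤ b → ∃ d ∈ D, p < d ∧ d < q

namespace LongOrder

section Order

variable {X : Type*} [LinearOrder X] [LongOrder X]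

instance : DenselyOrdered X where
  dense p q hpq := by
    obtain ⟨D, -, hD⟩ := exists_countable_dense q
    obtain ⟨d, -, h⟩ := hD p q hpq le_rfl
    exact ⟨d, h⟩

instance : CountableInterFilter (atTop : Filter X) where
  countable_sInter_mem S hS h := by
    choose! b hb using fun s hs => mem_atTop_sets.1 (h s hs)
    obtain ⟨c, hc⟩ := bddAbove_of_countable (b '' S) (hS.image b)
    exact mem_atTop_sets.2 ⟨c, fun y hy s hs => hb s hs y ((hc ⟨s, hs, rfl⟩).trans hy)⟩

/-- Closure under suprema of strictly increasing sequences. -/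
def SeqSupClosed (C : Set X) : Prop :=
  ∀ (u : ℕ → X) (a : X), StrictMono u → (∀ n, u n ∈ C) → IsLUB (range u) a → a ∈ C

lemma exists_isLUB_range (u : ℕ → X) : ∃ a, IsLUB (range u) a :=
  exists_isLUB _ (range_nonempty u) (bddAbove_of_countable _ (countable_range u))

lemma exists_mem_iInter {C : ℕ → Set X} (hC : ∀ n, SeqSupClosed (C n))
    (hC' : ∀ n b, ∃ c ∈ C n, b < c) (b : X) : ∃ c ∈ ⋂ n, C n, b < c := by
  choose next hmem hlt using hC'
  let u : ℕ → X := fun k => Nat.rec b (fun k x => next k.unpair.1 x) k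
  have hu : StrictMono u := strictMono_nat_of_lt_succ fun k => hlt _ _
  obtain ⟨a, ha⟩ := exists_isLUB_range u
  refine ⟨a, mem_iInter.2 fun n => ?_, (hu Nat.zero_lt_one).trans_le (ha.1 ⟨1, rfl⟩)⟩
  have hφ : StrictMono fun k => Nat.pair n k + 1 := fun i j hij =>
    Nat.succ_lt_succ (Nat.pair_lt_pair_right n hij)
  refine hC n (fun k => u (Nat.pair n k + 1)) a (hu.comp hφ) (fun k => ?_) ?_
  · have : u (Nat.pair n k + 1) = next n (u (Nat.pair n k)) := by
      change next (Nat.pair n k).unpair.1 _ = _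
      rw [Nat.unpair_pair]
    rw [this]
    exact hmem _ _
  · refine ⟨?_, fun c hc => ha.2 ?_⟩
    · rintro _ ⟨k, rfl⟩
      exact ha.1 (mem_range_self (Nat.pair n k + 1))
    · rintro _ ⟨k, rfl⟩
      exact (hu.monotone (hφ.le_apply (x := k))).trans (hc ⟨k, rfl⟩)

variable (X) in
/-- The filter generated by the unbounded sets closed under suprema of increasing sequences. -/
def clubFilter : Filter X :=
  Filter.ofCountableInter
    {s | ∃ C ⊆ s, SeqSupClosed C ∧ ∀ b, ∃ c ∈ C, b < c}
    (fun S hS h => by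
      have h' : ∀ s ∈ S, ∃ C ⊆ s, SeqSupClosed C ∧ ∀ b, ∃ c ∈ C, b < c := fun s hs => h hs
      choose! C hCs hC hC' using h'
      rcases S.eq_empty_or_nonempty with rfl | hne
      · exact ⟨univ, by simp, fun _ _ _ _ _ => mem_univ _, fun b => by simpa using exists_gt b⟩
      obtain ⟨e, rfl⟩ := hS.exists_eq_range hne
      refine ⟨⋂ n, C (e n), ?_, ?_, ?_⟩
      · exact subset_sInter (by
          rintro _ ⟨n, rfl⟩
          exact (iInter_subset _ n).trans (hCs _ ⟨n, rfl⟩))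
      · exact fun u a hu huC ha => mem_iInter.2 fun n =>
          hC _ ⟨n, rfl⟩ u a hu (fun k => mem_iInter.1 (huC k) n) ha
      · exact exists_mem_iInter (fun n => hC _ ⟨n, rfl⟩) fun n => hC' _ ⟨n, rfl⟩)
    (fun _ _ ⟨C, hCs, hC⟩ hst => ⟨C, hCs.trans hst, hC⟩)

lemma mem_clubFilter {s : Set X} :
    s ∈ clubFilter X ↔ ∃ C ⊆ s, SeqSupClosed C ∧ ∀ b, ∃ c ∈ C, b < c := Iff.rfl

lemma exists_gt_of_eventually {p : X → Prop} (h : ∀ᶠ a in clubFilter X, p a) (b : X) :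
    ∃ a, p a ∧ b < a := by
  obtain ⟨C, hC, -, hC'⟩ := mem_clubFilter.1 h
  obtain ⟨c, hc, hbc⟩ := hC' b
  exact ⟨c, hC hc, hbc⟩

instance : (clubFilter X).NeBot := by
  rw [neBot_iff]
  intro h
  obtain ⟨b⟩ : Nonempty X := inferInstance
  have : ∀ᶠ a in clubFilter X, False := by simp [h]
  simpa using exists_gt_of_eventually this b

lemma clubFilter_le_atTop : clubFilter X ≤ atTop := by
  refine le_iInf fun b => le_principal_iff.2 (mem_clubFilter.2 ⟨Ici b, Subset.rfl, ?_, fun c => ?_⟩)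
  · exact fun u a hu huC ha => (huC 0).trans (ha.1 (mem_range_self 0))
  · obtain ⟨d, hd⟩ := exists_gt (max b c)
    exact ⟨d, (le_max_left _ _).trans hd.le, (le_max_right _ _).trans_lt hd⟩

/-- Closing off: club many points are closed under a monotone relation. -/
lemma eventually_forall_lt {R : X → X → Prop} (hR : ∀ b, ∃ c, R b c)
    (hl : ∀ b b' c, b' ≤ b → R b c → R b' c) (hr : ∀ b c c', c ≤ c' → R b c → R b c') :
    ∀ᶠ a in clubFilter X, ∀ b < a, R b a := by
  refine mem_clubFilter.2 ⟨_, Subset.rfl, fun u a hu huC ha b hb => ?_, fun b => ?_⟩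
  · obtain ⟨_, ⟨n, rfl⟩, hn⟩ := (lt_isLUB_iff ha).1 hb
    exact hr _ _ _ (ha.1 ⟨n, rfl⟩) (huC n b hn)
  · have : ∀ b, ∃ c, R b c ∧ b < c := fun b => by
      obtain ⟨c, hc⟩ := hR b
      obtain ⟨d, hd⟩ := exists_gt (max b c)
      exact ⟨d, hr _ _ _ ((le_max_right _ _).trans hd.le) hc, (le_max_left _ _).trans_lt hd⟩
    choose g hg hlt using this
    let u : ℕ → X := fun k => Nat.rec b (fun _ x => g x) k
    have hu : StrictMono u := strictMono_nat_of_lt_succ fun k => hlt _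
    obtain ⟨a, ha⟩ := exists_isLUB_range u
    refine ⟨a, fun b' hb' => ?_, (hu Nat.zero_lt_one).trans_le (ha.1 ⟨1, rfl⟩)⟩
    obtain ⟨_, ⟨n, rfl⟩, hn⟩ := (lt_isLUB_iff ha).1 hb'
    exact hr _ _ _ (ha.1 ⟨n + 1, rfl⟩) (hl _ _ _ hn.le (hg (u n)))

/-- `f` is eventually constant. -/
def EvConst (f : X → X) : Prop := ∃ c, ∀ᶠ y in atTop, f y = c

lemma not_evConst_of_injective {f : X → X} (hf : Function.Injective f) : ¬ EvConst f := by
  rintro ⟨c, hc⟩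
  obtain ⟨y, hy⟩ := eventually_atTop.1 hc
  obtain ⟨z, hz⟩ := exists_gt y
  exact hz.ne (hf ((hy y le_rfl).trans (hy z hz.le).symm))

lemma not_evConst_fst_and_snd {e : X × X → X × X} (he : Function.Injective e) (x : X)
    (h1 : EvConst fun y => (e (x, y)).1) (h2 : EvConst fun y => (e (x, y)).2) : False := by
  obtain ⟨c, hc⟩ := h1
  obtain ⟨d, hd⟩ := h2
  obtain ⟨y, hy⟩ := eventually_atTop.1 (hc.and hd)
  obtain ⟨z, hz⟩ := exists_gt y
  have : e (x, y) = e (x, z) := Prod.ext ((hy y le_rfl).1.trans (hy z hz.le).1.symm)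
    ((hy y le_rfl).2.trans (hy z hz.le).2.symm)
  exact hz.ne (Prod.ext_iff.1 (he this)).2

end Order

section Topology

variable {X : Type*} [LinearOrder X] [LongOrder X] [TopologicalSpace X] [OrderTopology X]

instance : PreconnectedSpace X := by
  classical
  let S : Set X → X := fun s => if h : ∃ a, IsLUB s a then h.choose else Classical.arbitrary X
  let I : Set X → X := fun s => if h : ∃ a, IsGLB s a then h.choose else Classical.arbitrary X
  have hS : ∀ s a, IsLUB s a → IsLUB s (S s) := fun s a ha => by
    have h : ∃ a, IsLUB s a := ⟨a, ha⟩
    simpa only [S, dif_pos h] using h.choose_spec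
  have hI : ∀ s a, IsGLB s a → IsGLB s (I s) := fun s a ha => by
    have h : ∃ a, IsGLB s a := ⟨a, ha⟩
    simpa only [I, dif_pos h] using h.choose_spec
  let _ : ConditionallyCompleteLinearOrder X :=
    { (inferInstance : LinearOrder X), (inferInstance : Lattice X) with
      sSup := S
      sInf := I
      isLUB_csSup := fun s hs hb => by
        obtain ⟨a, ha⟩ := exists_isLUB s hs hb
        exact hS s a ha
      isGLB_csInf := fun s hs hb => by
        obtain ⟨a, ha⟩ := exists_isLUB (lowerBounds s) hb (hs.mono fun x hx y hy => hy hx)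
        exact hI s a (isLUB_lowerBounds.1 ha)
      csSup_of_not_bddAbove := fun s hs => by
        have h1 : ¬ ∃ a, IsLUB s a := fun ⟨a, ha⟩ => hs ⟨a, ha.1⟩
        have h2 : ¬ ∃ a, IsLUB (∅ : Set X) a := fun ⟨a, ha⟩ => by
          obtain ⟨b, hb⟩ := exists_lt a
          exact hb.not_ge (ha.2 (by simp))
        change S s = S ∅
        simp only [S, dif_neg h1, dif_neg h2]
      csInf_of_not_bddBelow := fun s hs => by
        have h1 : ¬ ∃ a, IsGLB s a := fun ⟨a, ha⟩ => hs ⟨a, ha.1⟩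
        have h2 : ¬ ∃ a, IsGLB (∅ : Set X) a := fun ⟨a, ha⟩ => by
          obtain ⟨b, hb⟩ := exists_gt a
          exact hb.not_ge (ha.2 (by simp))
        change I s = I ∅
        simp only [I, dif_neg h1, dif_neg h2] }
  exact ordered_connected_space

instance : FirstCountableTopology X where
  nhds_generated_countable x := by
    obtain ⟨b, hb⟩ := exists_gt x
    obtain ⟨D, hDc, hD⟩ := exists_countable_dense b
    have h : (𝓝 x).HasBasis (fun i : X × X => i.1 ∈ D ∧ i.2 ∈ D ∧ i.1 < x ∧ x < i.2)
        fun i => Ioo i.1 i.2 := by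
      refine (nhds_basis_Ioo x).to_hasBasis (fun i hi => ?_) fun i hi => ⟨i, hi.2.2, Subset.rfl⟩
      obtain ⟨p, hp, hp1, hp2⟩ := hD i.1 x hi.1 hb.le
      obtain ⟨q, hq, hq1, hq2⟩ := hD x (min b i.2) (lt_min hb hi.2) (min_le_left _ _)
      exact ⟨(p, q), ⟨hp, hq, hp2, hq1⟩,
        Ioo_subset_Ioo hp1.le (hq2.le.trans (min_le_right _ _))⟩
    exact HasCountableBasis.isCountablyGenerated
      (p := fun i : X × X => i.1 ∈ D ∧ i.2 ∈ D ∧ i.1 < x ∧ x < i.2)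
      ⟨h, (hDc.prod hDc).mono fun i hi => mk_mem_prod hi.1 hi.2.1⟩

lemma exists_countable_Iic_subset_closure (b : X) :
    ∃ D : Set X, D.Countable ∧ Iic b ⊆ closure D := by
  obtain ⟨D, hDc, hD⟩ := exists_countable_dense b
  refine ⟨D, hDc, fun x hx => mem_closure_iff_nhds.2 fun t ht => ?_⟩
  obtain ⟨l, hl, hlt⟩ := exists_Ioc_subset_of_mem_nhds ht (exists_lt x)
  obtain ⟨d, hd, h1, h2⟩ := hD l x hl hx
  exact ⟨d, hlt ⟨h1, h2.le⟩, hd⟩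

/-- A closed condition on points below `b` can be checked at countably many points. -/
lemma exists_countable_forall_le (b : X) : ∃ D : Set X, D.Countable ∧
    ∀ p : X → Prop, IsClosed {x | p x} → (∀ x ∈ D, p x) → ∀ x ≤ b, p x := by
  obtain ⟨D, hDc, hD⟩ := exists_countable_Iic_subset_closure b
  exact ⟨D, hDc, fun p hp hpD x hx => closure_minimal (t := {x | p x}) hpD hp (hD hx)⟩

lemma eventually_mem_of_isClosed {C : Set X} (hC : IsClosed C) (hf : ∃ᶠ y in atTop, y ∈ C) :
    ∀ᶠ a in clubFilter X, a ∈ C := by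
  refine mem_clubFilter.2 ⟨C, Subset.rfl, fun u a hu huC ha => ?_, fun b => ?_⟩
  · exact hC.mem_of_tendsto (tendsto_atTop_isLUB hu.monotone ha) (.of_forall huC)
  · obtain ⟨c, hbc, hc⟩ := frequently_atTop'.1 hf b
    exact ⟨c, hc, hbc⟩

lemma forall_le_of_forall_lt {p : X → Prop} (hp : IsClosed {x | p x}) {a : X}
    (h : ∀ x < a, p x) : p a := by
  have : a ∈ closure (Iio a) := by rw [closure_Iio]; exact self_mem_Iic
  exact closure_minimal (t := {x | p x}) h hp this

lemma eventually_gt_or_lt {f : X → X} (hf : Continuous f) {p q : X} (hpq : p < q) :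
    (∀ᶠ y in atTop, p < f y) ∨ ∀ᶠ y in atTop, f y < q := by
  by_contra h
  simp only [not_or, not_eventually, not_lt] at h
  have h1 := eventually_mem_of_isClosed (isClosed_le hf continuous_const) h.1
  have h2 := eventually_mem_of_isClosed (isClosed_le continuous_const hf) h.2
  obtain ⟨a, ha1, ha2⟩ := (h1.and h2).exists
  exact (hpq.trans_le (le_trans ha2 ha1)).false

lemma eventually_ge_of_not_evConst {f : X → X} (hf : Continuous f) (hc : ¬ EvConst f) (b : X) :
    ∀ᶠ y in atTop, b ≤ f y := by
  by_contra hb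
  refine hc ?_
  obtain ⟨b', hbb'⟩ := exists_gt b
  have hlt : ∀ᶠ y in atTop, f y < b' :=
    (eventually_gt_or_lt hf hbb').resolve_left fun h => hb (h.mono fun _ => le_of_lt)
  obtain ⟨D, hDc, hD⟩ := exists_countable_dense b'
  let P : X → Prop := fun p => ∀ᶠ y in atTop, p < f y
  let K : X → Prop := fun y => ∀ p ∈ D, ∀ q ∈ D, p < q → (P p ∧ p < f y) ∨ (¬ P p ∧ f y < q)
  have hK : ∀ᶠ y in atTop, K y := by
    refine (eventually_countable_ball hDc).2 fun p _ =>
      (eventually_countable_ball hDc).2 fun q _ => ?_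
    by_cases hpq : p < q
    · by_cases h : P p
      · filter_upwards [h] with y hy _ using Or.inl ⟨h, hy⟩
      · filter_upwards [(eventually_gt_or_lt hf hpq).resolve_left h]
          with y hy _ using Or.inr ⟨h, hy⟩
    · exact .of_forall fun y h => absurd h hpq
  have not_lt : ∀ y y', K y → K y' → f y' < b' → ¬ f y < f y' := by
    intro y y' hy hy' hb' hlt
    obtain ⟨q, hq, hq1, hq2⟩ := hD _ _ hlt hb'.le
    obtain ⟨p, hp, hp1, hp2⟩ := hD _ _ hq1 (hq2.trans hb').le
    rcases hy p hp q hq hp2 with ⟨-, h⟩ | ⟨h, -⟩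
    · exact hp1.not_gt h
    · rcases hy' p hp q hq hp2 with ⟨h', -⟩ | ⟨-, h'⟩
      · exact h h'
      · exact hq2.not_gt h'
  obtain ⟨y, hy, hyb⟩ := (hK.and hlt).exists
  exact ⟨f y, (hK.and hlt).mono fun y' ⟨hy', hyb'⟩ =>
    le_antisymm (le_of_not_gt (not_lt y y' hy hy' hyb')) (le_of_not_gt (not_lt y' y hy' hy hyb))⟩

end Topology
/-- The limits of eventually constant maps along a convergent sequence converge. -/
lemma eventually_tendsto_of_evConst {X Y : Type*} [TopologicalSpace X] [Preorder Y]
    [TopologicalSpace Y] [CountableInterFilter (atTop : Filter Y)] {G : X × Y → X}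
    (hG : Continuous G) {u c : ℕ → X} {x : X}
    (hu : Tendsto u atTop (𝓝 x)) (hc : ∀ n, ∀ᶠ y in atTop, G (u n, y) = c n) :
    ∀ᶠ y in atTop, Tendsto c atTop (𝓝 (G (x, y))) := by
  filter_upwards [eventually_countable_forall.2 hc] with y hy
  have : Tendsto (fun n => G (u n, y)) atTop (𝓝 (G (x, y))) :=
    (hG.tendsto _).comp (hu.prodMk_nhds tendsto_const_nhds)
  simpa only [hy] using this

lemma image_setOf_eq_iff {Z : Type*} [TopologicalSpace Z] (h : Z ≃ₜ Z) (p q : Z → Prop) :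
    h '' {z | p z} = {z | q z} ↔ (∀ z, p z → q (h z)) ∧ ∀ z, q z → p (h.symm z) := by
  rw [h.image_eq_preimage_symm]
  refine ⟨fun H => ⟨fun z hz => ?_, fun z hz => ?_⟩, fun H => ?_⟩
  · have : h z ∈ h.symm ⁻¹' {z | p z} := by simpa using hz
    rwa [H] at this
  · have : z ∈ {z | q z} := hz
    rwa [← H] at this
  · ext z
    exact ⟨fun hz => by simpa using H.1 _ hz, H.2 z⟩

lemma image_horizontal_eq_horizontal_iff {X : Type*} [TopologicalSpace X]
    (h : X × X ≃ₜ X × X) (a : X) :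
    h '' {p | p.2 = a} = {p | p.2 = a} ↔
      (∀ x, (h (x, a)).2 = a) ∧ ∀ x, (h.symm (x, a)).2 = a := by
  simp [image_setOf_eq_iff]

lemma image_horizontal_eq_vertical_iff {X : Type*} [TopologicalSpace X]
    (h : X × X ≃ₜ X × X) (a : X) :
    h '' {p | p.2 = a} = {p | p.1 = a} ↔
      (∀ x, (h (x, a)).1 = a) ∧ ∀ y, (h.symm (a, y)).2 = a := by
  rw [image_setOf_eq_iff]
  exact ⟨fun H => ⟨fun x => H.1 (x, a) rfl, fun y => H.2 (a, y) rfl⟩,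
    fun H => ⟨by rintro ⟨x, _⟩ rfl; exact H.1 x, by rintro ⟨_, y⟩ rfl; exact H.2 y⟩⟩

lemma isClosed_setOf_image_horizontal_eq_horizontal {X : Type*} [TopologicalSpace X]
    [T2Space X] (h : X × X ≃ₜ X × X) :
    IsClosed {a : X | h '' {p | p.2 = a} = {p | p.2 = a}} := by
  simp only [image_horizontal_eq_horizontal_iff, ofPred_and, ofPred_forall]
  exact (isClosed_iInter fun x => isClosed_eq (by fun_prop) (by fun_prop)).inter
    (isClosed_iInter fun x => isClosed_eq (by fun_prop) (by fun_prop))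

lemma isClosed_setOf_image_horizontal_eq_vertical {X : Type*} [TopologicalSpace X]
    [T2Space X] (h : X × X ≃ₜ X × X) :
    IsClosed {a : X | h '' {p | p.2 = a} = {p | p.1 = a}} := by
  simp only [image_horizontal_eq_vertical_iff, ofPred_and, ofPred_forall]
  exact (isClosed_iInter fun x => isClosed_eq (by fun_prop) (by fun_prop)).inter
    (isClosed_iInter fun x => isClosed_eq (by fun_prop) (by fun_prop))

section Plane

variable {X : Type*} [LinearOrder X] [LongOrder X] [TopologicalSpace X] [OrderTopology X]

lemma eventually_forall_lt_apply_eq {G : X × X → X} (hG : Continuous G)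
    (hc : ∀ x, ¬ EvConst fun y => G (x, y)) : ∀ᶠ a in clubFilter X, ∀ x < a, G (x, a) = a := by
  have h1 : ∀ᶠ a in clubFilter X, ∀ b < a, ∀ x ≤ b, ∀ y ≤ b, G (x, y) ≤ a := by
    refine eventually_forall_lt (fun b => ?_) (fun b b' c hb h x hx y hy => h x (hx.trans hb) y
      (hy.trans hb)) (fun b c c' hc h x hx y hy => (h x hx y hy).trans hc)
    obtain ⟨D, hDc, hD⟩ := exists_countable_forall_le b
    obtain ⟨B, hB⟩ := bddAbove_of_countable (G '' D ×ˢ D) ((hDc.prod hDc).image G)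
    refine ⟨B, hD (fun x => ∀ y ≤ b, G (x, y) ≤ B) ?_ fun x hx =>
      hD (fun y => G (x, y) ≤ B) ?_ fun y hy => hB ⟨(x, y), ⟨hx, hy⟩, rfl⟩⟩
    · simp only [ofPred_forall]
      exact isClosed_iInter fun y => isClosed_iInter fun _ =>
        isClosed_le (by fun_prop) continuous_const
    · exact isClosed_le (by fun_prop) continuous_const
  have h2 : ∀ᶠ a in clubFilter X, ∀ b < a, ∀ x ≤ b, ∀ y ≥ a, b ≤ G (x, y) := by
    refine eventually_forall_lt (fun b => ?_) (fun b b' c hb h x hx y hy => hb.trans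
      (h x (hx.trans hb) y hy)) (fun b c c' hc h x hx y hy => h x hx y (hc.trans hy))
    obtain ⟨D, hDc, hD⟩ := exists_countable_forall_le b
    obtain ⟨c, hcD⟩ := eventually_atTop.1 ((eventually_countable_ball hDc).2 fun x _ =>
      eventually_ge_of_not_evConst (f := fun y => G (x, y)) (by fun_prop) (hc x) b)
    refine ⟨c, hD (fun x => ∀ y ≥ c, b ≤ G (x, y)) ?_ fun x hx y hy => hcD y hy x hx⟩
    simp only [ofPred_forall]
    exact isClosed_iInter fun y => isClosed_iInter fun _ =>
      isClosed_le continuous_const (by fun_prop)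
  filter_upwards [h1, h2] with a h1 h2 x hx
  refine le_antisymm ?_ (le_of_forall_lt_imp_le_of_dense fun b hb => ?_)
  · refine forall_le_of_forall_lt (p := fun y => G (x, y) ≤ a)
      (isClosed_le (by fun_prop) continuous_const) fun y hy => ?_
    exact h1 _ (max_lt hx hy) x (le_max_left _ _) y (le_max_right _ _)
  · exact (le_max_left b x).trans (h2 _ (max_lt hb hx) x (le_max_right _ _) a le_rfl)

lemma eventually_apply_eq {f : X → X} (hf : Continuous f) (hc : ¬ EvConst f) :
    ∀ᶠ a in clubFilter X, f a = a := by
  filter_upwards [eventually_forall_lt_apply_eq (G := fun p => f p.2) (by fun_prop) fun _ => hc]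
    with a ha
  obtain ⟨x, hx⟩ := exists_lt a
  exact ha x hx

lemma isClosed_setOf_evConst {G : X × X → X} (hG : Continuous G) :
    IsClosed {x | EvConst fun y => G (x, y)} := by
  refine IsSeqClosed.isClosed fun u x hu hx => ?_
  choose c hc using hu
  have h := eventually_tendsto_of_evConst hG hx hc
  obtain ⟨y, hy⟩ := h.exists
  exact ⟨G (x, y), h.mono fun z hz => tendsto_nhds_unique hz hy⟩

lemma exists_continuous_of_evConst {G : X × X → X} (hG : Continuous G)
    (hc : ∀ x, EvConst fun y => G (x, y)) :
    ∃ c : X → X, Continuous c ∧ ∀ x, ∀ᶠ y in atTop, G (x, y) = c x := by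
  choose c hc using hc
  refine ⟨c, continuous_iff_seqContinuous.2 fun u x hu => ?_, hc⟩
  obtain ⟨y, hy, hy'⟩ :=
    ((eventually_tendsto_of_evConst hG hu fun n => hc (u n)).and (hc x)).exists
  exact hy' ▸ hy

lemma forall_evConst_fst_or_snd {e : X × X → X × X} (hc : Continuous e)
    (he : Function.Injective e) :
    (∀ x, EvConst fun y => (e (x, y)).1) ∨ ∀ x, EvConst fun y => (e (x, y)).2 := by
  let A : Set X := {x | EvConst fun y => (e (x, y)).1}
  let B : Set X := {x | EvConst fun y => (e (x, y)).2}
  have hA : IsClosed A := isClosed_setOf_evConst (G := fun p => (e p).1) (by fun_prop)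
  have hB : IsClosed B := isClosed_setOf_evConst (G := fun p => (e p).2) (by fun_prop)
  have hAB : Disjoint A B := disjoint_left.2 fun x h1 h2 => not_evConst_fst_and_snd he x h1 h2
  have hsub : (A ∪ B)ᶜ.Subsingleton := by
    have key : ∀ x ∈ (A ∪ B)ᶜ, ∀ᶠ a in clubFilter X, e (x, a) = (a, a) := fun x hx => by
      filter_upwards [eventually_apply_eq (f := fun y => (e (x, y)).1) (by fun_prop)
        fun h => hx (Or.inl h), eventually_apply_eq (f := fun y => (e (x, y)).2) (by fun_prop)
        fun h => hx (Or.inr h)] with a h1 h2 using Prod.ext h1 h2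
    intro x hx x' hx'
    obtain ⟨a, h1, h2⟩ := ((key x hx).and (key x' hx')).exists
    exact (Prod.ext_iff.1 (he (h1.trans h2.symm))).1
  have huniv : A ∪ B = univ := by
    have : IsClopen (A ∪ B)ᶜ := ⟨hsub.isClosed, (hA.union hB).isOpen_compl⟩
    rcases isClopen_iff.1 this with h | h
    · exact compl_empty_iff.1 h
    · rw [h] at hsub
      exact absurd hsub (not_subsingleton_iff.2 nontrivial_univ)
  have hAc : A = Bᶜ :=
    (isCompl_iff.2 ⟨hAB, codisjoint_iff.2 huniv⟩).eq_compl
  have : IsClopen A := ⟨hA, hAc ▸ hB.isOpen_compl⟩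
  rcases isClopen_iff.1 this with h | h
  · right
    intro x
    have : x ∈ A ∪ B := huniv ▸ mem_univ x
    rwa [h, empty_union] at this
  · exact Or.inl fun x => (h ▸ mem_univ x : x ∈ A)

/-- If the images of distinct lines go to infinity in the second coordinate,
their limits in the first coordinate are distinct. -/
lemma injective_of_eventually_fst_eq {e : X × X → X × X} (hc : Continuous e)
    (he : Function.Injective e) {c : X → X} (h : ∀ x, ∀ᶠ y in atTop, (e (x, y)).1 = c x) :
    Function.Injective c := by
  have key : ∀ x, ∀ᶠ a in clubFilter X, e (x, a) = (c x, a) := fun x => by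
    filter_upwards [(h x).filter_mono clubFilter_le_atTop,
      eventually_apply_eq (f := fun y => (e (x, y)).2) (by fun_prop)
      (not_evConst_fst_and_snd he x ⟨_, h x⟩)] with a h1 h2 using Prod.ext h1 h2
  intro x x' hxx'
  obtain ⟨a, h1, h2⟩ := ((key x).and (key x')).exists
  rw [← hxx'] at h2
  exact (Prod.ext_iff.1 (he (h1.trans h2.symm))).1

lemma exists_eventually_fst_eq {e : X × X → X × X} (hc : Continuous e)
    (he : Function.Injective e) (h : ∀ x, EvConst fun y => (e (x, y)).1) :
    ∃ c : X → X, Continuous c ∧ (∀ x, ∀ᶠ y in atTop, (e (x, y)).1 = c x) ∧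
      ∀ᶠ a in clubFilter X, c a = a := by
  obtain ⟨c, hcc, hce⟩ := exists_continuous_of_evConst (G := fun p => (e p).1) (by fun_prop) h
  exact ⟨c, hcc, hce,
    eventually_apply_eq hcc (not_evConst_of_injective (injective_of_eventually_fst_eq hc he hce))⟩

lemma forall_evConst_snd_of_fst {e : X × X → X × X} (hc : Continuous e)
    (he : Function.Injective e) (h : ∀ x, EvConst fun y => (e (x, y)).1) (y : X) :
    EvConst fun x => (e (x, y)).2 := by
  refine (forall_evConst_fst_or_snd (e := e ∘ Prod.swap) (by fun_prop)
    (he.comp Prod.swap_injective)).resolve_left (fun h' => ?_) y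
  obtain ⟨c, -, hce, hca⟩ := exists_eventually_fst_eq hc he h
  obtain ⟨d, -, hde, hda⟩ := exists_eventually_fst_eq (e := e ∘ Prod.swap) (by fun_prop)
    (he.comp Prod.swap_injective) h'
  obtain ⟨a, hca, hda⟩ := (hca.and hda).exists
  obtain ⟨b, ⟨⟨⟨h1, h2⟩, h3⟩, h4⟩, hab⟩ := exists_gt_of_eventually
    (((((hce a).filter_mono clubFilter_le_atTop).and
      ((hde a).filter_mono clubFilter_le_atTop)).and
    (eventually_apply_eq (f := fun y => (e (a, y)).2) (by fun_prop)
      (not_evConst_fst_and_snd he a (h a)))).and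
    (eventually_apply_eq (f := fun y => (e (y, a)).2) (by fun_prop)
      (not_evConst_fst_and_snd (e := e ∘ Prod.swap) (he.comp Prod.swap_injective) a (h' a)))) a
  have : e (a, b) = e (b, a) :=
    Prod.ext ((h1.trans hca).trans (h2.trans hda).symm) (h3.trans h4.symm)
  exact hab.ne (Prod.ext_iff.1 (he this)).1

lemma eventually_forall_snd_eq {e : X × X → X × X} (hc : Continuous e)
    (he : Function.Injective e) (h : ∀ x, EvConst fun y => (e (x, y)).1) :
    ∀ᶠ a in clubFilter X, ∀ x, (e (x, a)).2 = a := by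
  obtain ⟨d, -, hde, hda⟩ := exists_eventually_fst_eq (e := Prod.swap ∘ e ∘ Prod.swap)
    (by fun_prop) (Prod.swap_injective.comp (he.comp Prod.swap_injective))
    (forall_evConst_snd_of_fst hc he h)
  have hde : ∀ y, ∀ᶠ x in atTop, (e (x, y)).2 = d y := hde
  have h1 : ∀ᶠ a in clubFilter X, ∀ b < a, ∀ y ≤ b, ∀ x ≥ a, ∀ x' ≥ a,
      (e (x, y)).2 = (e (x', y)).2 := by
    refine eventually_forall_lt (fun b => ?_) (fun b b' c hb h y hy => h y (hy.trans hb))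
      (fun b c c' hc h y hy x hx x' hx' => h y hy x (hc.trans hx) x' (hc.trans hx'))
    obtain ⟨D, hDc, hD⟩ := exists_countable_forall_le b
    obtain ⟨c, hcD⟩ := eventually_atTop.1 ((eventually_countable_ball hDc).2 fun y _ => hde y)
    refine ⟨c, hD (fun y => ∀ x ≥ c, ∀ x' ≥ c, (e (x, y)).2 = (e (x', y)).2) ?_
      fun y hy x hx x' hx' => (hcD x hx y hy).trans (hcD x' hx' y hy).symm⟩
    simp only [ofPred_forall]
    exact isClosed_iInter fun x => isClosed_iInter fun _ => isClosed_iInter fun x' =>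
      isClosed_iInter fun _ => isClosed_eq (by fun_prop) (by fun_prop)
  filter_upwards [h1, hda, eventually_forall_lt_apply_eq (G := fun p => (e p).2) (by fun_prop)
    fun x => not_evConst_fst_and_snd he x (h x)] with a h1 hda h2 x
  rcases lt_or_ge x a with hx | hx
  · exact h2 x hx
  · have key : ∀ x' ≥ a, (e (x, a)).2 = (e (x', a)).2 := fun x' hx' =>
      forall_le_of_forall_lt (p := fun y => (e (x, y)).2 = (e (x', y)).2)
        (isClosed_eq (by fun_prop) (by fun_prop)) fun y hy => h1 y hy y le_rfl x hx x' hx'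
    obtain ⟨x', hx', hx''⟩ := ((hde a).and (eventually_ge_atTop a)).exists
    rw [key x' hx'', hx', hda]

lemma eventually_preserves_or_swaps {e : X × X → X × X} (hc : Continuous e)
    (he : Function.Injective e) :
    (∀ᶠ a in clubFilter X, (∀ x, (e (x, a)).2 = a) ∧ ∀ y, (e (a, y)).1 = a) ∨
    (∀ᶠ a in clubFilter X, (∀ x, (e (x, a)).1 = a) ∧ ∀ y, (e (a, y)).2 = a) := by
  have key : ∀ e : X × X → X × X, Continuous e → Function.Injective e →
      (∀ x, EvConst fun y => (e (x, y)).1) →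
      ∀ᶠ a in clubFilter X, (∀ x, (e (x, a)).2 = a) ∧ ∀ y, (e (a, y)).1 = a :=
    fun e hc he h => (eventually_forall_snd_eq hc he h).and <|
      eventually_forall_snd_eq (e := Prod.swap ∘ e ∘ Prod.swap) (by fun_prop)
        (Prod.swap_injective.comp (he.comp Prod.swap_injective))
        (forall_evConst_snd_of_fst hc he h)
  exact (forall_evConst_fst_or_snd hc he).imp (key e hc he)
    (key (Prod.swap ∘ e) (by fun_prop) (Prod.swap_injective.comp he))

theorem eventually_image_horizontal_eq (h : X × X ≃ₜ X × X) :
    (∀ᶠ a in clubFilter X, h '' {p | p.2 = a} = {p | p.2 = a}) ∨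
    (∀ᶠ a in clubFilter X, h '' {p | p.2 = a} = {p | p.1 = a}) := by
  simp only [image_horizontal_eq_horizontal_iff, image_horizontal_eq_vertical_iff]
  rcases eventually_preserves_or_swaps h.continuous h.injective with h1 | h1 <;>
    rcases eventually_preserves_or_swaps h.symm.continuous h.symm.injective with h2 | h2
  · exact Or.inl (h1.mp (h2.mono fun a h2 h1 => ⟨h1.1, h2.1⟩))
  · obtain ⟨a, h1, h2⟩ := (h1.and h2).exists
    obtain ⟨b, hb⟩ := exists_ne a
    have : h (b, a) = ((h (b, a)).1, a) := Prod.ext rfl (h1.1 b)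
    have h3 := h2.1 (h (b, a)).1
    rw [← this, h.symm_apply_apply] at h3
    exact absurd h3 hb
  · obtain ⟨a, h1, h2⟩ := (h1.and h2).exists
    obtain ⟨b, hb⟩ := exists_ne a
    have : h (b, a) = (a, (h (b, a)).2) := Prod.ext (h1.1 b) rfl
    have h3 := h2.2 (h (b, a)).2
    rw [← this, h.symm_apply_apply] at h3
    exact absurd h3 hb
  · exact Or.inr (h1.mp (h2.mono fun a h2 h1 => ⟨h1.1, h2.2⟩))

end Plane

end LongOrder

namespace Omega1

instance : OrderTopology Omega1 :=
  have : OrdConnected {o : Ordinal.{0} | o < (Cardinal.aleph 1).ord} := ordConnected_Iio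
  orderTopology_of_ordConnected (t := {o : Ordinal.{0} | o < (Cardinal.aleph 1).ord})

lemma bddAbove_of_countable (s : Set Omega1) (hs : s.Countable) : BddAbove s := by
  have := hs.to_subtype
  have h : ⨆ i : s, i.1.1 < (Cardinal.aleph 1).ord :=
    (Ordinal.iSup_lt_omega_one fun i : s => i.1.2.trans_eq (Cardinal.ord_aleph 1)).trans_eq
      (Cardinal.ord_aleph 1).symm
  refine ⟨⟨_, h⟩, fun a ha => ?_⟩
  change a.1 ≤ ⨆ i : s, i.1.1
  exact Ordinal.le_iSup (fun i : s => i.1.1) ⟨a, ha⟩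

lemma countable_Iic (b : Omega1) : (Iic b).Countable := by
  have h : (Iio (Order.succ b.1)).Countable := by
    rw [← Cardinal.le_aleph0_iff_set_countable, Cardinal.mk_Iio_ordinal, Cardinal.lift_le_aleph0,
      ← Cardinal.lt_aleph_one_iff, ← Cardinal.lt_ord]
    exact (Cardinal.isSuccLimit_ord (Cardinal.aleph0_le_aleph 1)).succ_lt b.2
  exact (h.preimage Subtype.val_injective).mono fun a ha =>
    Order.lt_succ_of_le (α := Ordinal) (a := a.1) (b := b.1) ha

lemma exists_succ (b : Omega1) : ∃ c, b < c ∧ ∀ a < c, a ≤ b :=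
  ⟨⟨Order.succ b.1, (Cardinal.isSuccLimit_ord (Cardinal.aleph0_le_aleph 1)).succ_lt b.2⟩,
    Order.lt_succ b.1, fun a ha =>
      Order.le_of_lt_succ (α := Ordinal) (a := a.1) (b := b.1) ha⟩

lemma o0_le (a : Omega1) : o0 ≤ a := zero_le (a := a.1)

end Omega1

namespace LongRayCl

lemma lt_mk_iff {x : LongRayCl} {a : Omega1} {t : Ico01} :
    x < toLex (a, t) ↔ (ofLex x).1 < a ∨ (ofLex x).1 = a ∧ (ofLex x).2 < t := Prod.Lex.lt_iff

lemma mk_lt_iff {x : LongRayCl} {a : Omega1} {t : Ico01} :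
    toLex (a, t) < x ↔ a < (ofLex x).1 ∨ a = (ofLex x).1 ∧ t < (ofLex x).2 := Prod.Lex.lt_iff

lemma le_mk_iff {x : LongRayCl} {a : Omega1} {t : Ico01} :
    x ≤ toLex (a, t) ↔ (ofLex x).1 < a ∨ (ofLex x).1 = a ∧ (ofLex x).2 ≤ t := Prod.Lex.le_iff

lemma mk_le_iff {x : LongRayCl} {a : Omega1} {t : Ico01} :
    toLex (a, t) ≤ x ↔ a < (ofLex x).1 ∨ a = (ofLex x).1 ∧ t ≤ (ofLex x).2 := Prod.Lex.le_iff

lemma r0_le (t : Ico01) : r0 ≤ t := t.2.1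

lemma lzero_le (x : LongRayCl) : lzero ≤ x := by
  rw [lzero, mk_le_iff]
  exact (Omega1.o0_le _).lt_or_eq.imp_right fun h => ⟨h, r0_le _⟩

lemma fst_le_of_le {x y : LongRayCl} (h : x ≤ y) : (ofLex x).1 ≤ (ofLex y).1 := by
  rcases Prod.Lex.le_iff.1 h with h | h
  exacts [h.le, h.1.le]

lemma exists_isLUB (s : Set LongRayCl) (hs : BddAbove s) : ∃ a, IsLUB s a := by
  obtain ⟨b, hb⟩ := hs
  have hne : {c : Omega1 | ∀ x ∈ s, (ofLex x).1 ≤ c}.Nonempty :=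
    ⟨(ofLex b).1, fun x hx => fst_le_of_le (hb hx)⟩
  obtain ⟨a, ha, hmin⟩ := WellFounded.has_min wellFounded_lt _ hne
  have hmin : ∀ c : LongRayCl, c ∈ upperBounds s → a ≤ (ofLex c).1 := fun c hc =>
    not_lt.1 (hmin _ fun x hx => fst_le_of_le (hc hx))
  by_cases hex : ∃ t : Ico01, toLex (a, t) ∈ s
  · obtain ⟨t, ht⟩ := hex
    let T : Set ℝ := {r | ∃ t : Ico01, toLex (a, t) ∈ s ∧ t.1 = r}
    obtain ⟨m, hm⟩ : ∃ m, IsLUB T m := Real.exists_isLUB ⟨t, t, ht, rfl⟩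
      ⟨1, by rintro _ ⟨t, -, rfl⟩; exact t.2.2.le⟩
    have hm0 : 0 ≤ m := t.2.1.trans (hm.1 ⟨t, ht, rfl⟩)
    rcases lt_or_ge m 1 with hm1 | hm1
    · refine ⟨toLex (a, ⟨m, hm0, hm1⟩), fun x hx => ?_, fun c hc => ?_⟩
      · rw [le_mk_iff]
        exact (ha x hx).lt_or_eq.imp_right fun h => ⟨h, hm.1 ⟨(ofLex x).2, by rwa [← h], rfl⟩⟩
      · rw [mk_le_iff]
        refine (hmin c hc).lt_or_eq.imp_right fun h => ⟨h, hm.2 ?_⟩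
        rintro _ ⟨t, ht, rfl⟩
        have := mk_le_iff.1 (hc ht)
        exact (this.resolve_left (h ▸ lt_irrefl _)).2
    · obtain ⟨a', haa', ha'⟩ := Omega1.exists_succ a
      refine ⟨toLex (a', r0), fun x hx => le_mk_iff.2 (Or.inl ((ha x hx).trans_lt haa')),
        fun c hc => ?_⟩
      rw [mk_le_iff]
      have hne : (ofLex c).1 ≠ a := fun h => by
        have : m ≤ (ofLex c).2.1 := hm.2 (by
          rintro _ ⟨t, ht, rfl⟩
          exact ((mk_le_iff.1 (hc ht)).resolve_left (h ▸ lt_irrefl _)).2)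
        exact (hm1.trans this).not_gt (ofLex c).2.2.2
      have : a' ≤ (ofLex c).1 := not_lt.1 fun h => hne ((ha' _ h).antisymm (hmin c hc))
      exact this.lt_or_eq.imp_right fun h => ⟨h, r0_le _⟩
  · refine ⟨toLex (a, r0), fun x hx => le_mk_iff.2 (Or.inl ((ha x hx).lt_of_ne fun h =>
      hex ⟨(ofLex x).2, by rwa [← h]⟩)), fun c hc => mk_le_iff.2 ?_⟩
    exact (hmin c hc).lt_or_eq.imp_right fun h => ⟨h, r0_le _⟩

lemma exists_countable_dense (b : LongRayCl) : ∃ D : Set LongRayCl, D.Countable ∧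
    ∀ p q, p < q → q ≤ b → ∃ d ∈ D, p < d ∧ d < q := by
  let Q : Set Ico01 := {t | ∃ r : ℚ, (r : ℝ) = t.1}
  have hQ : Q.Countable :=
    (countable_range ((↑) : ℚ → ℝ)).preimage Subtype.val_injective
  have hQd : ∀ s : ℝ, 0 ≤ s → ∀ u ≤ 1, s < u → ∃ t ∈ Q, s < t.1 ∧ t.1 < u := fun s hs u hu hsu => by
    obtain ⟨r, h1, h2⟩ := exists_rat_btwn hsu
    exact ⟨⟨r, hs.trans h1.le, h2.trans_le hu⟩, ⟨r, rfl⟩, h1, h2⟩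
  refine ⟨toLex '' (Iic (ofLex b).1 ×ˢ Q), ((Omega1.countable_Iic _).prod hQ).image _,
    fun p q hpq hqb => ?_⟩
  rcases Prod.Lex.lt_iff.1 hpq with h | ⟨h, h'⟩
  · obtain ⟨t, ht, h1, h2⟩ := hQd (ofLex p).2 (ofLex p).2.2.1 1 le_rfl (ofLex p).2.2.2
    exact ⟨toLex ((ofLex p).1, t), ⟨(_, t), ⟨h.le.trans (fst_le_of_le hqb), ht⟩, rfl⟩,
      lt_mk_iff.2 (Or.inr ⟨rfl, h1⟩), mk_lt_iff.2 (Or.inl h)⟩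
  · obtain ⟨t, ht, h1, h2⟩ := hQd (ofLex p).2 (ofLex p).2.2.1 _ (ofLex q).2.2.2.le h'
    exact ⟨toLex ((ofLex p).1, t), ⟨(_, t), ⟨h.le.trans (fst_le_of_le hqb), ht⟩, rfl⟩,
      lt_mk_iff.2 (Or.inr ⟨rfl, h1⟩), mk_lt_iff.2 (Or.inr ⟨h, h2⟩)⟩

lemma exists_gt_of_countable (s : Set LongRayCl) (hs : s.Countable) :
    ∃ a : LongRayCl, ∀ x ∈ s, x < a := by
  obtain ⟨a, ha⟩ := Omega1.bddAbove_of_countable _ (hs.image fun x => (ofLex x).1)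
  obtain ⟨b, hb, -⟩ := Omega1.exists_succ a
  exact ⟨toLex (b, r0), fun x hx => lt_mk_iff.2 (Or.inl ((ha ⟨x, hx, rfl⟩).trans_lt hb))⟩

end LongRayCl

namespace LongRay

lemma lzero_lt (x : LongRay) : lzero < x.1 := (LongRayCl.lzero_le _).lt_of_ne x.2.symm

instance : OrderTopology LongRay :=
  have : OrdConnected {x : LongRayCl | x ≠ lzero} :=
    ⟨fun x hx _ _ _ hz => ((LongRayCl.lzero_le x).lt_of_ne hx.symm |>.trans_le hz.1).ne'⟩
  orderTopology_of_ordConnected (t := {x : LongRayCl | x ≠ lzero})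

lemma exists_countable_dense (b : LongRayCl) : ∃ D : Set LongRay, D.Countable ∧
    ∀ p q : LongRayCl, p < q → q ≤ b → ∃ d ∈ D, p < d.1 ∧ d.1 < q := by
  obtain ⟨D, hDc, hD⟩ := LongRayCl.exists_countable_dense b
  refine ⟨Subtype.val ⁻¹' D, hDc.preimage Subtype.val_injective, fun p q hpq hqb => ?_⟩
  obtain ⟨d, hd, h1, h2⟩ := hD p q hpq hqb
  exact ⟨⟨d, ((LongRayCl.lzero_le p).trans_lt h1).ne'⟩, hd, h1, h2⟩

lemma exists_gt_of_countable (s : Set LongRay) (hs : s.Countable) :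
    ∃ a : LongRay, ∀ x ∈ s, x < a := by
  obtain ⟨a, ha⟩ := LongRayCl.exists_gt_of_countable (insert lzero (Subtype.val '' s))
    ((hs.image _).insert _)
  exact ⟨⟨a, (ha _ (mem_insert _ _)).ne'⟩, fun x hx => ha _ (mem_insert_of_mem _ ⟨x, hx, rfl⟩)⟩

instance : LongOrder LongRay where
  exists_pair_ne := by
    obtain ⟨a, -⟩ := exists_gt_of_countable ∅ countable_empty
    obtain ⟨b, hb⟩ := exists_gt_of_countable {a} (countable_singleton a)
    exact ⟨a, b, (hb a rfl).ne⟩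
  exists_lt x := by
    obtain ⟨D, -, hD⟩ := exists_countable_dense x.1
    obtain ⟨d, -, -, h⟩ := hD _ _ (lzero_lt x) le_rfl
    exact ⟨d, h⟩
  exists_gt x := by
    obtain ⟨b, hb⟩ := exists_gt_of_countable {x} (countable_singleton x)
    exact ⟨b, hb x rfl⟩
  bddAbove_of_countable s hs := by
    obtain ⟨b, hb⟩ := exists_gt_of_countable s hs
    exact ⟨b, fun x hx => (hb x hx).le⟩
  exists_isLUB s hs hb := by
    obtain ⟨b, hb⟩ := hb
    obtain ⟨x, hx⟩ := hs
    obtain ⟨a, ha⟩ := LongRayCl.exists_isLUB (Subtype.val '' s)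
      ⟨b.1, by rintro _ ⟨y, hy, rfl⟩; exact hb hy⟩
    refine ⟨⟨a, ((lzero_lt x).trans_le (ha.1 ⟨x, hx, rfl⟩)).ne'⟩, fun y hy => ha.1 ⟨y, hy, rfl⟩,
      fun c hc => ha.2 (?_ : c.1 ∈ _)⟩
    rintro _ ⟨y, hy, rfl⟩
    exact hc hy
  exists_countable_dense b := by
    obtain ⟨D, hDc, hD⟩ := exists_countable_dense b.1
    exact ⟨D, hDc, fun p q => hD p.1 q.1⟩

lemma eventually_mem_range_atOrd :
    ∀ᶠ a in LongOrder.clubFilter LongRay, ∃ (α : Omega1) (hα : α ≠ o0), a = atOrd α hα := by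
  refine LongOrder.mem_clubFilter.2 ⟨_, Subset.rfl, fun u a hu huC ha => ?_, fun b => ?_⟩
  · choose v hv hvu using huC
    have hv' : ∀ n, (u n).1 = toLex (v n, r0) := fun n => by rw [hvu n]; rfl
    have hlt : ∀ n, toLex (v n, r0) < a.1 := fun n => by
      rw [← hv']
      exact (hu n.lt_succ_self).trans_le (ha.1 ⟨n + 1, rfl⟩)
    have hvlt : ∀ n, v n < v (n + 1) := fun n => by
      have : (u n).1 < (u (n + 1)).1 := hu n.lt_succ_self
      rw [hv', hv', LongRayCl.lt_mk_iff] at this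
      exact this.resolve_right fun h => h.2.false
    have hle : ∀ n, v n < (ofLex a.1).1 := fun n =>
      (hvlt n).trans_le (LongRayCl.fst_le_of_le (hlt (n + 1)).le)
    have hne : (ofLex a.1).1 ≠ o0 := ((Omega1.o0_le _).trans_lt (hle 0)).ne'
    refine ⟨_, hne, ha.unique ⟨?_, fun c hc => ?_⟩⟩
    · rintro _ ⟨n, rfl⟩
      change (u n).1 ≤ toLex _
      rw [hv']
      exact LongRayCl.le_mk_iff.2 (Or.inl (hle n))
    · refine le_trans ?_ (ha.2 hc)
      change toLex _ ≤ a.1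
      exact LongRayCl.mk_le_iff.2 (Or.inr ⟨rfl, LongRayCl.r0_le _⟩)
  · obtain ⟨c, hc, -⟩ := Omega1.exists_succ (ofLex b.1).1
    exact ⟨atOrd c ((Omega1.o0_le _).trans_lt hc).ne', ⟨c, _, rfl⟩,
      LongRayCl.lt_mk_iff.2 (Or.inl hc)⟩

lemma continuous_toLex_r0 : Continuous fun α : Omega1 => (toLex (α, r0) : LongRayCl) := by
  refine OrderTopology.continuous_iff.2 fun x => ⟨?_, ?_⟩
  · have : (fun α : Omega1 => (toLex (α, r0) : LongRayCl)) ⁻¹' Ioi x = Ioi (ofLex x).1 := by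
      ext α
      exact LongRayCl.lt_mk_iff.trans
        (or_iff_left fun h => (LongRayCl.r0_le _).not_gt h.2)
    rw [this]
    exact isOpen_Ioi
  · by_cases h : r0 < (ofLex x).2
    · obtain ⟨c, hc, hc'⟩ := Omega1.exists_succ (ofLex x).1
      have : (fun α : Omega1 => (toLex (α, r0) : LongRayCl)) ⁻¹' Iio x = Iio c := by
        ext α
        refine LongRayCl.mk_lt_iff.trans ⟨fun h => ?_, fun h' => ?_⟩
        · exact (h.elim le_of_lt fun h => h.1.le).trans_lt hc
        · exact (hc' α h').lt_or_eq.imp_right fun h' => ⟨h', h⟩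
      rw [this]
      exact isOpen_Iio
    · have : (fun α : Omega1 => (toLex (α, r0) : LongRayCl)) ⁻¹' Iio x = Iio (ofLex x).1 := by
        ext α
        exact LongRayCl.mk_lt_iff.trans (or_iff_left fun h' => h h'.2)
      rw [this]
      exact isOpen_Iio

lemma isOpen_singleton_o0 : IsOpen ({o0} : Set Omega1) := by
  obtain ⟨c, hc, hc'⟩ := Omega1.exists_succ o0
  have : ({o0} : Set Omega1) = Iio c := by
    ext α
    exact ⟨fun h => (mem_singleton_iff.1 h).symm ▸ hc,
      fun h => (hc' α h).antisymm (Omega1.o0_le α)⟩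
  rw [this]
  exact isOpen_Iio

lemma isClubIn_of_isClosed_of_eventually {p : LongRay → Prop} (hp : IsClosed {a | p a})
    (hp' : ∀ᶠ a in LongOrder.clubFilter LongRay, p a) :
    IsClubIn {α : Omega1 | ∃ hα : α ≠ o0, p (atOrd α hα)} := by
  constructor
  · have hc : Continuous fun α : ({o0}ᶜ : Set Omega1) => atOrd α.1 α.2 :=
      (continuous_toLex_r0.comp continuous_subtype_val).subtype_mk _
    have : {α : Omega1 | ∃ hα : α ≠ o0, p (atOrd α hα)} =
        Subtype.val '' ((fun α : ({o0}ᶜ : Set Omega1) => atOrd α.1 α.2) ⁻¹' {a | p a}) := by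
      ext α
      exact ⟨fun ⟨h, h'⟩ => ⟨⟨α, h⟩, h', rfl⟩, by rintro ⟨⟨α, h⟩, h', rfl⟩; exact ⟨h, h'⟩⟩
    rw [this]
    exact (isOpen_singleton_o0.isClosed_compl.isClosedEmbedding_subtypeVal).isClosedMap _
      (hp.preimage hc)
  · intro β
    obtain ⟨c, hc, -⟩ := Omega1.exists_succ β
    obtain ⟨a, ⟨ha, α, hα, rfl⟩, hlt⟩ := LongOrder.exists_gt_of_eventually
      (hp'.and eventually_mem_range_atOrd) (atOrd c ((Omega1.o0_le _).trans_lt hc).ne')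
    refine ⟨α, ⟨hα, ha⟩, hc.trans_le ?_⟩
    exact LongRayCl.fst_le_of_le (show toLex (c, r0) ≤ toLex (α, r0) from le_of_lt hlt)

end LongRay

/-- For every homeomorphism `h : L₊² → L₊²`, either
`{α ∈ ω₁ ∖ {0} : h(L₊ × {α}) = L₊ × {α}}` is a closed unbounded subset of `ω₁`, or
`{α ∈ ω₁ ∖ {0} : h(L₊ × {α}) = {α} × L₊}` is a closed unbounded subset of `ω₁`. -/
theorem homeo_lines_club (h : (LongRay × LongRay) ≃ₜ (LongRay × LongRay)) :
    IsClubIn {α : Omega1 |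
      ∃ hα : α ≠ o0, ⇑h '' horizLine (atOrd α hα) = horizLine (atOrd α hα)} ∨
    IsClubIn {α : Omega1 |
      ∃ hα : α ≠ o0, ⇑h '' horizLine (atOrd α hα) = vertLine (atOrd α hα)} := by
  exact (LongOrder.eventually_image_horizontal_eq h).imp
    (LongRay.isClubIn_of_isClosed_of_eventually
      (LongOrder.isClosed_setOf_image_horizontal_eq_horizontal h))
    (LongRay.isClubIn_of_isClosed_of_eventually
      (LongOrder.isClosed_setOf_image_horizontal_eq_vertical h))

end
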